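/- arXiv:1710.04870 — 3 statements merged into one kernel-verified Lean document; each statement's English description precedes it below -/
import Mathlib

section
/- Let n ∈ ℕ, let b ∈ ℕ with b > n/2, and let ℓ ∈ ℕ. Then there exists a constant C > 0, independent of t, such that ‖m²_{b,ℓ,H}(·,t)‖₂ ≤ C t^{b−1} e^{−t/2} for all t ≥ 1. -/
open MeasureTheory

/-- `f(r,c,t) = cos(t·√(r²−c))`. -/
noncomputable def fDW (r c t : ℝ) : ℝ := Real.cos (t * Real.sqrt (r ^ 2 - c))

/-- `g(r,a,t) = exp(−2tr²/(1+√(1−4ar²)))`. -/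
noncomputable def gDW (r a t : ℝ) : ℝ :=
  Real.exp (-(2 * t * r ^ 2) / (1 + Real.sqrt (1 - 4 * a * r ^ 2)))

/-- `h(r,a,t) = (1−4ar²)^{−1/2}·exp(−2tr²/(1+√(1−4ar²)))`. -/
noncomputable def hDW (r a t : ℝ) : ℝ :=
  (Real.sqrt (1 - 4 * a * r ^ 2))⁻¹ *
    Real.exp (-(2 * t * r ^ 2) / (1 + Real.sqrt (1 - 4 * a * r ^ 2)))

/-- `W¹_b(ξ,t) = Σ_{k=0}^{b−1} (1/4)^k (1/k!) ∂_c^k f(|ξ|,0,t)` (as a function of `r = |ξ|`). -/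
noncomputable def W1 (b : ℕ) (r t : ℝ) : ℝ :=
  ∑ k ∈ Finset.range b,
    (1/4 : ℝ) ^ k * (1 / (Nat.factorial k) : ℝ) * iteratedDeriv k (fun c => fDW r c t) 0

/-- `W²_b(ξ,t) = 2t⁻¹ Σ_{k=0}^{b−2} (1/4)^k (1/k!) ∂_c^{k+1} f(|ξ|,0,t)` for `b ≥ 2`,
and `W²_1 = 0` (the empty sum). -/
noncomputable def W2 (b : ℕ) (r t : ℝ) : ℝ :=
  2 * t⁻¹ * ∑ k ∈ Finset.range (b - 1),
    (1/4 : ℝ) ^ k * (1 / (Nat.factorial k) : ℝ) * iteratedDeriv (k + 1) (fun c => fDW r c t) 0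

/-- `D¹_ℓ(ξ,t) = (1/2) Σ_{k=0}^{ℓ−1} (1/k!) ∂_a^k g(|ξ|,0,t)`. -/
noncomputable def D1 (l : ℕ) (r t : ℝ) : ℝ :=
  (1/2 : ℝ) * ∑ k ∈ Finset.range l,
    (1 / (Nat.factorial k) : ℝ) * iteratedDeriv k (fun a => gDW r a t) 0

/-- `D²_ℓ(ξ,t) = Σ_{k=0}^{ℓ−1} (1/k!) ∂_a^k h(|ξ|,0,t)`. -/
noncomputable def D2 (l : ℕ) (r t : ℝ) : ℝ :=
  ∑ k ∈ Finset.range l,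
    (1 / (Nat.factorial k) : ℝ) * iteratedDeriv k (fun a => hDW r a t) 0

/-- The Fourier multiplier `K₀(t,ξ)` of the damped wave evolution (as a function of `r = |ξ|`). -/
noncomputable def K0 (t r : ℝ) : ℝ :=
  if r ≤ 1/2 then Real.exp (-t/2) * Real.cosh (t * Real.sqrt (1/4 - r ^ 2))
  else Real.exp (-t/2) * Real.cos (t * Real.sqrt (r ^ 2 - 1/4))

/-- The Fourier multiplier `K₁(t,ξ)` of the damped wave evolution (as a function of `r = |ξ|`). -/
noncomputable def K1 (t r : ℝ) : ℝ :=
  if r < 1/2 then Real.exp (-t/2) * Real.sinh (t * Real.sqrt (1/4 - r ^ 2)) / Real.sqrt (1/4 - r ^ 2)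
  else if r = 1/2 then t * Real.exp (-t/2)
  else Real.exp (-t/2) * Real.sin (t * Real.sqrt (r ^ 2 - 1/4)) / Real.sqrt (r ^ 2 - 1/4)

/-- A Taylor estimate on `[0, 1]` for a sequence of successive derivatives. -/
theorem abs_sub_taylor_sum_le {x₀ M : ℝ} (hx₀ : x₀ ≤ 1) (m : ℕ) (F : ℕ → ℝ → ℝ)
    (hF : ∀ k, ∀ x ∈ Set.Icc 0 x₀, HasDerivAt (F k) (F (k + 1) x) x)
    (hM : ∀ x ∈ Set.Icc 0 x₀, |F m x| ≤ M) :
    ∀ x ∈ Set.Icc 0 x₀,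
      |F 0 x - ∑ k ∈ Finset.range m, x ^ k * (1 / (k.factorial : ℝ)) * F k 0| ≤ M := by
  induction m generalizing F with
  | zero => simpa using hM
  | succ m ih =>
    intro x hx
    have ih' := ih (fun k => F (k + 1)) (fun k => hF (k + 1)) hM
    have hM0 : 0 ≤ M := (abs_nonneg _).trans (hM x hx)
    set E : ℝ → ℝ := fun x =>
      F 0 x - ∑ k ∈ Finset.range (m + 1), x ^ k * (1 / (k.factorial : ℝ)) * F k 0 with hE
    have hE0 : E 0 = 0 := by
      simp [hE, Finset.sum_range_succ']
    have hderiv : ∀ y ∈ Set.Icc 0 x₀, HasDerivWithinAt E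
        (F 1 y - ∑ k ∈ Finset.range m, y ^ k * (1 / (k.factorial : ℝ)) * F (k + 1) 0)
        (Set.Icc 0 x₀) y := by
      intro y hy
      refine HasDerivAt.hasDerivWithinAt ((hF 0 y hy).sub ?_)
      have hs : HasDerivAt
          (fun x : ℝ => ∑ k ∈ Finset.range (m + 1), x ^ k * (1 / (k.factorial : ℝ)) * F k 0)
          (∑ k ∈ Finset.range (m + 1), ((k : ℝ) * y ^ (k - 1)) * (1 / (k.factorial : ℝ)) * F k 0)
          y :=
        HasDerivAt.fun_sum fun k _ => ((hasDerivAt_pow k y).mul_const _).mul_const _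
      refine hs.congr_deriv ?_
      rw [Finset.sum_range_succ']
      simp only [CharP.cast_eq_zero, zero_mul, add_zero]
      refine Finset.sum_congr rfl fun k _ => ?_
      have : (k.factorial : ℝ) ≠ 0 := by positivity
      have h1 : ((k : ℝ) + 1) ≠ 0 := by positivity
      rw [Nat.factorial_succ]
      push_cast
      field_simp
    have hle := (convex_Icc (0 : ℝ) x₀).norm_image_sub_le_of_norm_hasDerivWithin_le hderiv
      (fun y hy => by simpa using ih' y hy) ⟨le_rfl, hx.1.trans hx.2⟩ hx
    rw [hE0, sub_zero, sub_zero, Real.norm_eq_abs, Real.norm_eq_abs, abs_of_nonneg hx.1] at hle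
    exact hle.trans (mul_le_of_le_one_right hM0 (hx.2.trans hx₀))

/-- Successive derivatives on an open set are the iterated derivatives. -/
theorem iteratedDeriv_eq_of_hasDerivAt {U : Set ℝ} (hU : IsOpen U) (F : ℕ → ℝ → ℝ)
    (hF : ∀ k, ∀ x ∈ U, HasDerivAt (F k) (F (k + 1) x) x) (k : ℕ) :
    ∀ x ∈ U, iteratedDeriv k (F 0) x = F k x := by
  induction k with
  | zero => simp
  | succ k ih =>
    intro x hx
    rw [iteratedDeriv_succ]
    have : iteratedDeriv k (F 0) =ᶠ[nhds x] F k :=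
      Filter.eventually_of_mem (hU.mem_nhds hx) ih
    rw [this.deriv_eq, (hF k x hx).deriv]

/-- A sequence of successive derivatives from a graded family of spaces of functions which is
stable under differentiation in the last variable. -/
theorem exists_seq_hasDerivAt (V : ℕ → Submodule ℝ (ℝ → ℝ → ℝ → ℝ)) (U : ℝ → Set ℝ)
    (hV : ∀ k, ∀ F ∈ V k, ∃ G ∈ V (k + 1), ∀ r t, ∀ x ∈ U r, HasDerivAt (F r t) (G r t x) x)
    (F₀ : ℝ → ℝ → ℝ → ℝ) (hF₀ : F₀ ∈ V 0) :
    ∃ F : ℕ → ℝ → ℝ → ℝ → ℝ, F 0 = F₀ ∧ (∀ k, F k ∈ V k) ∧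
      ∀ k r t, ∀ x ∈ U r, HasDerivAt (F k r t) (F (k + 1) r t x) x := by
  choose! D hD hD' using hV
  let F : ℕ → ℝ → ℝ → ℝ → ℝ := fun k => Nat.rec F₀ (fun k G => D k G) k
  have hmem : ∀ k, F k ∈ V k := by
    intro k
    induction k with
    | zero => exact hF₀
    | succ k ih => exact hD k _ ih
  exact ⟨F, rfl, hmem, fun k => hD' k _ (hmem k)⟩

/-- Stability under differentiation passes from generators to spans. -/
theorem exists_hasDerivAt_of_mem_span {S : Set (ℝ → ℝ → ℝ → ℝ)}
    {W : Submodule ℝ (ℝ → ℝ → ℝ → ℝ)} {U : ℝ → Set ℝ}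
    (h : ∀ F ∈ S, ∃ G ∈ W, ∀ r t, ∀ x ∈ U r, HasDerivAt (F r t) (G r t x) x)
    {F : ℝ → ℝ → ℝ → ℝ} (hF : F ∈ Submodule.span ℝ S) :
    ∃ G ∈ W, ∀ r t, ∀ x ∈ U r, HasDerivAt (F r t) (G r t x) x := by
  induction hF using Submodule.span_induction with
  | mem F hF => exact h F hF
  | zero => exact ⟨0, W.zero_mem, fun r t x _ => hasDerivAt_const x 0⟩
  | add F₁ F₂ _ _ h₁ h₂ =>
    obtain ⟨G₁, hG₁, h₁⟩ := h₁
    obtain ⟨G₂, hG₂, h₂⟩ := h₂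
    exact ⟨G₁ + G₂, W.add_mem hG₁ hG₂, fun r t x hx => (h₁ r t x hx).add (h₂ r t x hx)⟩
  | smul a F _ h₁ =>
    obtain ⟨G, hG, h₁⟩ := h₁
    exact ⟨a • G, W.smul_mem a hG, fun r t x hx => (h₁ r t x hx).const_smul a⟩

/-- A bound up to constants passes from generators to spans. -/
theorem exists_bound_of_mem_span {S : Set (ℝ → ℝ → ℝ → ℝ)} {P : ℝ → ℝ → ℝ → Prop}
    {B : ℝ → ℝ → ℝ → ℝ} (hB : ∀ r t x, P r t x → 0 ≤ B r t x)
    (h : ∀ F ∈ S, ∃ C : ℝ, ∀ r t x, P r t x → |F r t x| ≤ C * B r t x)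
    {F : ℝ → ℝ → ℝ → ℝ} (hF : F ∈ Submodule.span ℝ S) :
    ∃ C : ℝ, 0 ≤ C ∧ ∀ r t x, P r t x → |F r t x| ≤ C * B r t x := by
  induction hF using Submodule.span_induction with
  | mem F hF =>
    obtain ⟨C, hC⟩ := h F hF
    exact ⟨|C|, abs_nonneg _, fun r t x hP => (hC r t x hP).trans
      (mul_le_mul_of_nonneg_right (le_abs_self C) (hB r t x hP))⟩
  | zero => exact ⟨0, le_rfl, fun r t x _ => by simp⟩
  | add F₁ F₂ _ _ h₁ h₂ =>
    obtain ⟨C₁, hC₁, h₁⟩ := h₁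
    obtain ⟨C₂, hC₂, h₂⟩ := h₂
    refine ⟨C₁ + C₂, add_nonneg hC₁ hC₂, fun r t x hP => ?_⟩
    rw [add_mul]
    exact (abs_add_le _ _).trans (add_le_add (h₁ r t x hP) (h₂ r t x hP))
  | smul a F _ h₁ =>
    obtain ⟨C, hC, h₁⟩ := h₁
    refine ⟨|a| * C, by positivity, fun r t x hP => ?_⟩
    simp only [Pi.smul_apply, smul_eq_mul, abs_mul, mul_assoc]
    exact mul_le_mul_of_nonneg_left (h₁ r t x hP) (abs_nonneg a)

/-- The cosine terms occurring in the `c`-derivatives of `fDW`. -/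
noncomputable def cosTerm (j m : ℕ) (r t c : ℝ) : ℝ :=
  t ^ j * (Real.sqrt (r ^ 2 - c))⁻¹ ^ m * Real.cos (t * Real.sqrt (r ^ 2 - c))

/-- The sine terms occurring in the `c`-derivatives of `fDW`. -/
noncomputable def sinTerm (j m : ℕ) (r t c : ℝ) : ℝ :=
  t ^ j * (Real.sqrt (r ^ 2 - c))⁻¹ ^ m * Real.sin (t * Real.sqrt (r ^ 2 - c))

/-- The oscillating terms with at most `k` powers of `t` and at least `k` powers of decay. -/
def waveTerms (k : ℕ) : Set (ℝ → ℝ → ℝ → ℝ) :=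
  {F | ∃ j m, j ≤ k ∧ k ≤ m ∧ (F = cosTerm j m ∨ F = sinTerm j m)}

theorem hasDerivAt_sqrt_sq_sub {r c : ℝ} (hc : c < r ^ 2) :
    HasDerivAt (fun c => Real.sqrt (r ^ 2 - c)) (-(1 / 2) * (Real.sqrt (r ^ 2 - c))⁻¹) c := by
  have h := ((hasDerivAt_id c).const_sub (r ^ 2)).sqrt (sub_pos.2 hc).ne'
  refine h.congr_deriv ?_
  rw [id]
  ring

theorem hasDerivAt_inv_pow {u : ℝ → ℝ} {u' a : ℝ} (hu : HasDerivAt u u' a) (h0 : u a ≠ 0) (m : ℕ) :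
    HasDerivAt (fun a => (u a)⁻¹ ^ m) (-(m : ℝ) * (u a)⁻¹ ^ (m + 1) * u') a := by
  refine ((hu.fun_inv h0).fun_pow m).congr_deriv ?_
  cases m with
  | zero => simp
  | succ m =>
    rw [Nat.add_sub_cancel, inv_pow, inv_pow]
    push_cast
    field_simp
    ring

theorem hasDerivAt_inv_sqrt_sq_sub_pow {r c : ℝ} (hc : c < r ^ 2) (m : ℕ) :
    HasDerivAt (fun c => (Real.sqrt (r ^ 2 - c))⁻¹ ^ m)
      ((m : ℝ) / 2 * (Real.sqrt (r ^ 2 - c))⁻¹ ^ (m + 2)) c :=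
  (hasDerivAt_inv_pow (hasDerivAt_sqrt_sq_sub hc)
    (Real.sqrt_pos.2 (sub_pos.2 hc)).ne' m).congr_deriv (by ring)

theorem hasDerivAt_cosTerm (j m : ℕ) {r t c : ℝ} (hc : c < r ^ 2) :
    HasDerivAt (cosTerm j m r t)
      ((m : ℝ) / 2 * cosTerm j (m + 2) r t c + 1 / 2 * sinTerm (j + 1) (m + 1) r t c) c := by
  have h := ((hasDerivAt_inv_sqrt_sq_sub_pow hc m).const_mul (t ^ j)).fun_mul
    ((hasDerivAt_sqrt_sq_sub hc).const_mul t).cos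
  refine h.congr_deriv ?_
  simp only [cosTerm, sinTerm]
  ring

theorem hasDerivAt_sinTerm (j m : ℕ) {r t c : ℝ} (hc : c < r ^ 2) :
    HasDerivAt (sinTerm j m r t)
      ((m : ℝ) / 2 * sinTerm j (m + 2) r t c + -(1 / 2) * cosTerm (j + 1) (m + 1) r t c) c := by
  have h := ((hasDerivAt_inv_sqrt_sq_sub_pow hc m).const_mul (t ^ j)).fun_mul
    ((hasDerivAt_sqrt_sq_sub hc).const_mul t).sin
  refine h.congr_deriv ?_
  simp only [cosTerm, sinTerm]
  ring

theorem exists_hasDerivAt_waveTerms (k : ℕ) (F : ℝ → ℝ → ℝ → ℝ)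
    (hF : F ∈ Submodule.span ℝ (waveTerms k)) :
    ∃ G ∈ Submodule.span ℝ (waveTerms (k + 1)),
      ∀ r t, ∀ x ∈ Set.Iio (r ^ 2), HasDerivAt (F r t) (G r t x) x := by
  refine exists_hasDerivAt_of_mem_span (U := fun r => Set.Iio (r ^ 2)) ?_ hF
  have hcos : ∀ {j m}, j ≤ k + 1 → k + 1 ≤ m →
      cosTerm j m ∈ Submodule.span ℝ (waveTerms (k + 1)) := fun hj hm =>
    Submodule.subset_span ⟨_, _, hj, hm, Or.inl rfl⟩
  have hsin : ∀ {j m}, j ≤ k + 1 → k + 1 ≤ m →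
      sinTerm j m ∈ Submodule.span ℝ (waveTerms (k + 1)) := fun hj hm =>
    Submodule.subset_span ⟨_, _, hj, hm, Or.inr rfl⟩
  rintro F ⟨j, m, hj, hm, rfl | rfl⟩
  · exact ⟨((m : ℝ) / 2) • cosTerm j (m + 2) + (1 / 2 : ℝ) • sinTerm (j + 1) (m + 1),
      Submodule.add_mem _ (Submodule.smul_mem _ _ (hcos (by omega) (by omega)))
        (Submodule.smul_mem _ _ (hsin (by omega) (by omega))),
      fun r t x hx => hasDerivAt_cosTerm j m hx⟩
  · exact ⟨((m : ℝ) / 2) • sinTerm j (m + 2) + (-(1 / 2) : ℝ) • cosTerm (j + 1) (m + 1),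
      Submodule.add_mem _ (Submodule.smul_mem _ _ (hsin (by omega) (by omega)))
        (Submodule.smul_mem _ _ (hcos (by omega) (by omega))),
      fun r t x hx => hasDerivAt_sinTerm j m hx⟩

theorem exists_bound_waveTerms (k : ℕ) {F : ℝ → ℝ → ℝ → ℝ}
    (hF : F ∈ Submodule.span ℝ (waveTerms k)) :
    ∃ C : ℝ, 0 ≤ C ∧ ∀ r t c, (1 ≤ r ∧ 1 ≤ t ∧ c ≤ 1 / 4) → |F r t c| ≤ C * (t ^ k * r⁻¹ ^ k) := by
  refine exists_bound_of_mem_span (B := fun r t _ => t ^ k * r⁻¹ ^ k)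
    (P := fun r t c => 1 ≤ r ∧ 1 ≤ t ∧ c ≤ 1 / 4) ?_ ?_ hF
  · rintro r t x ⟨hr, ht, -⟩
    positivity
  · rintro F ⟨j, m, hj, hm, hF⟩
    have key : ∀ r t c y : ℝ, (1 ≤ r ∧ 1 ≤ t ∧ c ≤ 1 / 4) → |y| ≤ 1 →
        |t ^ j * (Real.sqrt (r ^ 2 - c))⁻¹ ^ m * y| ≤ 2 ^ m * (t ^ k * r⁻¹ ^ k) := by
      rintro r t c y ⟨hr, ht, hc⟩ hy
      have hr0 : 0 < r := by linarith
      have hq : r / 2 ≤ Real.sqrt (r ^ 2 - c) := Real.le_sqrt_of_sq_le (by nlinarith)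
      have hq' : (Real.sqrt (r ^ 2 - c))⁻¹ ≤ 2 * r⁻¹ :=
        (inv_anti₀ (by positivity) hq).trans_eq (by field_simp)
      have h1 : (Real.sqrt (r ^ 2 - c))⁻¹ ^ m ≤ 2 ^ m * r⁻¹ ^ k := by
        calc (Real.sqrt (r ^ 2 - c))⁻¹ ^ m ≤ (2 * r⁻¹) ^ m :=
              pow_le_pow_left₀ (by positivity) hq' m
          _ = 2 ^ m * r⁻¹ ^ m := mul_pow _ _ _
          _ ≤ 2 ^ m * r⁻¹ ^ k := mul_le_mul_of_nonneg_left
              (pow_le_pow_of_le_one (by positivity) (inv_le_one_of_one_le₀ hr) hm) (by positivity)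
      have h2 : t ^ j ≤ t ^ k := pow_le_pow_right₀ ht hj
      have h3 : 0 ≤ (Real.sqrt (r ^ 2 - c))⁻¹ ^ m := by positivity
      have h4 : 0 ≤ t ^ j := by positivity
      rw [abs_mul, abs_of_nonneg (mul_nonneg h4 h3)]
      calc t ^ j * (Real.sqrt (r ^ 2 - c))⁻¹ ^ m * |y|
          ≤ t ^ j * (Real.sqrt (r ^ 2 - c))⁻¹ ^ m := mul_le_of_le_one_right (by positivity) hy
        _ ≤ t ^ k * (2 ^ m * r⁻¹ ^ k) := mul_le_mul h2 h1 h3 (h4.trans h2)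
        _ = 2 ^ m * (t ^ k * r⁻¹ ^ k) := by ring
    refine ⟨2 ^ m, fun r t c hP => ?_⟩
    rcases hF with rfl | rfl
    · exact key r t c _ hP (Real.abs_cos_le_one _)
    · exact key r t c _ hP (Real.abs_sin_le_one _)

/-- High-frequency bound for the oscillating part of `K1` minus its Taylor polynomial `W2`. -/
theorem exists_bound_sin_div_sub_W2 (b : ℕ) :
    ∃ C : ℝ, 0 ≤ C ∧ ∀ r t : ℝ, 1 ≤ r → 1 ≤ t →
      |Real.sin (t * Real.sqrt (r ^ 2 - 1 / 4)) / Real.sqrt (r ^ 2 - 1 / 4) - W2 (b + 1) r t|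
        ≤ C * (t ^ b * r⁻¹ ^ (b + 1)) := by
  obtain ⟨F, hF0, hmem, hF⟩ := exists_seq_hasDerivAt (fun k => Submodule.span ℝ (waveTerms k))
    (fun r => Set.Iio (r ^ 2)) exists_hasDerivAt_waveTerms (cosTerm 0 0)
    (Submodule.subset_span ⟨0, 0, le_rfl, le_rfl, Or.inl rfl⟩)
  obtain ⟨C, hC, hbd⟩ := exists_bound_waveTerms (b + 1) (hmem (b + 1))
  refine ⟨2 * C, by positivity, fun r t hr ht => ?_⟩
  have ht0 : 0 < t := by linarith
  have hIio : ∀ x ∈ Set.Icc (0 : ℝ) (1 / 4), x ∈ Set.Iio (r ^ 2) := fun x hx => by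
    have := hx.2
    simp only [Set.mem_Iio]
    nlinarith
  have h0 : (0 : ℝ) ∈ Set.Icc (0 : ℝ) (1 / 4) := by norm_num
  have h4 : (1 / 4 : ℝ) ∈ Set.Icc (0 : ℝ) (1 / 4) := by norm_num
  have hf : (fun c => fDW r c t) = F 0 r t := by
    ext c
    simp [hF0, cosTerm, fDW]
  have hiter : ∀ k, iteratedDeriv k (fun c => fDW r c t) 0 = F k r t 0 := fun k => by
    rw [hf]
    exact iteratedDeriv_eq_of_hasDerivAt isOpen_Iio (fun k => F k r t) (fun k => hF k r t) k 0
      (hIio 0 h0)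
  have hsin : Real.sin (t * Real.sqrt (r ^ 2 - 1 / 4)) / Real.sqrt (r ^ 2 - 1 / 4)
      = 2 * t⁻¹ * F 1 r t (1 / 4) := by
    have h1 := hF 0 r t _ (hIio _ h4)
    rw [hF0] at h1
    rw [h1.unique (hasDerivAt_cosTerm 0 0 (hIio _ h4))]
    simp only [sinTerm]
    push_cast
    field_simp
    ring
  have htaylor := abs_sub_taylor_sum_le (x₀ := 1 / 4) (by norm_num) b (fun k => F (k + 1) r t)
    (fun k x hx => hF (k + 1) r t x (hIio x hx))
    (fun x hx => hbd r t x ⟨hr, ht, hx.2⟩) (1 / 4) h4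
  have hW : W2 (b + 1) r t = 2 * t⁻¹ *
      ∑ k ∈ Finset.range b, (1 / 4 : ℝ) ^ k * (1 / (k.factorial : ℝ)) * F (k + 1) r t 0 := by
    simp only [W2, hiter, Nat.add_sub_cancel]
  rw [hsin, hW, ← mul_sub, abs_mul, abs_of_pos (show 0 < 2 * t⁻¹ by positivity)]
  calc _ ≤ 2 * t⁻¹ * (C * (t ^ (b + 1) * r⁻¹ ^ (b + 1))) :=
        mul_le_mul_of_nonneg_left htaylor (by positivity)
    _ = 2 * C * (t ^ b * r⁻¹ ^ (b + 1)) := by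
        rw [pow_succ t b]
        field_simp

/-- The terms occurring in the `a`-derivatives of `hDW`. -/
noncomputable def heatTerm (p q m s : ℕ) (r t a : ℝ) : ℝ :=
  r ^ p * t ^ q * (Real.sqrt (1 - 4 * a * r ^ 2))⁻¹ ^ m *
    (1 + Real.sqrt (1 - 4 * a * r ^ 2))⁻¹ ^ s *
    Real.exp (-(2 * t * r ^ 2) / (1 + Real.sqrt (1 - 4 * a * r ^ 2)))

/-- The set of all `heatTerm`s. -/
def heatTerms : Set (ℝ → ℝ → ℝ → ℝ) := {F | ∃ p q m s, F = heatTerm p q m s}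

theorem hasDerivAt_heatTerm (p q m s : ℕ) {r t a : ℝ} (ha : 0 < 1 - 4 * a * r ^ 2) :
    HasDerivAt (heatTerm p q m s r t)
      (2 * (m : ℝ) * heatTerm (p + 2) q (m + 2) s r t a +
        (2 * (s : ℝ) * heatTerm (p + 2) q (m + 1) (s + 1) r t a +
          -4 * heatTerm (p + 4) (q + 1) (m + 1) (s + 2) r t a)) a := by
  have hu : HasDerivAt (fun a => Real.sqrt (1 - 4 * a * r ^ 2))
      (-2 * r ^ 2 * (Real.sqrt (1 - 4 * a * r ^ 2))⁻¹) a := by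
    have h := ((((hasDerivAt_id a).const_mul 4).mul_const (r ^ 2)).const_sub 1).sqrt ha.ne'
    refine h.congr_deriv ?_
    rw [id]
    ring
  have hu0 : 0 < Real.sqrt (1 - 4 * a * r ^ 2) := Real.sqrt_pos.2 ha
  have hv := hu.const_add 1
  have hv0 : 1 + Real.sqrt (1 - 4 * a * r ^ 2) ≠ 0 := by positivity
  have hE : HasDerivAt (fun a => -(2 * t * r ^ 2) / (1 + Real.sqrt (1 - 4 * a * r ^ 2)))
      (-(2 * t * r ^ 2) * (-(1 + Real.sqrt (1 - 4 * a * r ^ 2))⁻¹ ^ 2 *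
        (-2 * r ^ 2 * (Real.sqrt (1 - 4 * a * r ^ 2))⁻¹))) a := by
    have h := (hasDerivAt_inv_pow hv hv0 1).const_mul (-(2 * t * r ^ 2))
    simp only [pow_one, Nat.cast_one] at h
    refine h.congr_deriv ?_
    ring
  have h := ((((hasDerivAt_inv_pow hu hu0.ne' m).const_mul (r ^ p * t ^ q)).fun_mul
    (hasDerivAt_inv_pow hv hv0 s)).fun_mul hE.exp)
  refine h.congr_deriv ?_
  simp only [heatTerm]
  ring

theorem exists_hasDerivAt_heatTerms (F : ℝ → ℝ → ℝ → ℝ)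
    (hF : F ∈ Submodule.span ℝ heatTerms) :
    ∃ G ∈ Submodule.span ℝ heatTerms,
      ∀ r t, ∀ x ∈ {a : ℝ | 0 < 1 - 4 * a * r ^ 2}, HasDerivAt (F r t) (G r t x) x := by
  refine exists_hasDerivAt_of_mem_span (U := fun r => {a : ℝ | 0 < 1 - 4 * a * r ^ 2}) ?_ hF
  have hmem : ∀ p q m s, heatTerm p q m s ∈ Submodule.span ℝ heatTerms := fun p q m s =>
    Submodule.subset_span ⟨p, q, m, s, rfl⟩
  rintro F ⟨p, q, m, s, rfl⟩
  exact ⟨(2 * (m : ℝ)) • heatTerm (p + 2) q (m + 2) s +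
      ((2 * (s : ℝ)) • heatTerm (p + 2) q (m + 1) (s + 1) +
        (-4 : ℝ) • heatTerm (p + 4) (q + 1) (m + 1) (s + 2)),
    Submodule.add_mem _ (Submodule.smul_mem _ _ (hmem _ _ _ _))
      (Submodule.add_mem _ (Submodule.smul_mem _ _ (hmem _ _ _ _))
        (Submodule.smul_mem _ _ (hmem _ _ _ _))),
    fun r t x hx => hasDerivAt_heatTerm p q m s hx⟩

theorem exists_bound_heatTerms (b : ℕ) {F : ℝ → ℝ → ℝ → ℝ}
    (hF : F ∈ Submodule.span ℝ heatTerms) :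
    ∃ C : ℝ, 0 ≤ C ∧ ∀ r t a, (1 ≤ r ∧ 1 ≤ t ∧ a = 0) →
      |F r t a| ≤ C * (Real.exp (-t / 2) * r⁻¹ ^ b) := by
  refine exists_bound_of_mem_span (B := fun r t _ => Real.exp (-t / 2) * r⁻¹ ^ b)
    (P := fun r t a => 1 ≤ r ∧ 1 ≤ t ∧ a = 0) ?_ ?_ hF
  · rintro r t x ⟨hr, ht, -⟩
    positivity
  · rintro F ⟨p, q, m, s, rfl⟩
    refine ⟨2 ^ (p + b + q) * (p + b + q).factorial, ?_⟩
    rintro r t a ⟨hr, ht, rfl⟩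
    have hr0 : 0 < r := by linarith
    have ht0 : 0 < t := by linarith
    have hrt : r ≤ t * r ^ 2 := by nlinarith [mul_le_mul ht hr zero_le_one ht0.le]
    have htr : t ≤ t * r ^ 2 := le_mul_of_one_le_right ht0.le (one_le_pow₀ hr)
    set N := p + b + q with hN
    have hpow : r ^ (p + b) * t ^ q ≤ (t * r ^ 2) ^ N := by
      rw [hN, pow_add _ (p + b) q]
      exact mul_le_mul (pow_le_pow_left₀ hr0.le hrt _) (pow_le_pow_left₀ ht0.le htr _)
        (by positivity) (by positivity)
    have hexp : (t * r ^ 2) ^ N ≤ 2 ^ N * N.factorial * Real.exp (t * r ^ 2 / 2) := by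
      have h := Real.pow_div_factorial_le_exp (t * r ^ 2 / 2) (by positivity) N
      rw [div_pow, div_div, div_le_iff₀ (by positivity)] at h
      linarith
    have hsplit : Real.exp (-(t * r ^ 2)) ≤ Real.exp (-(t * r ^ 2 / 2)) * Real.exp (-t / 2) := by
      rw [← Real.exp_add]
      exact Real.exp_le_exp.2 (by linarith)
    have hval : heatTerm p q m s r t 0 =
        r ^ p * t ^ q * (2 : ℝ)⁻¹ ^ s * Real.exp (-(t * r ^ 2)) := by
      have h2 : (1 : ℝ) + 1 = 2 := by norm_num
      simp only [heatTerm, mul_zero, zero_mul, sub_zero, Real.sqrt_one, inv_one, one_pow, mul_one,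
        h2]
      congr 2
      ring
    have hs : (2 : ℝ)⁻¹ ^ s ≤ 1 := pow_le_one₀ (by norm_num) (by norm_num)
    rw [hval, abs_of_nonneg (by positivity)]
    calc r ^ p * t ^ q * (2 : ℝ)⁻¹ ^ s * Real.exp (-(t * r ^ 2))
        ≤ r ^ p * t ^ q * Real.exp (-(t * r ^ 2)) :=
          mul_le_mul_of_nonneg_right (mul_le_of_le_one_right (by positivity) hs) (by positivity)
      _ = r ^ (p + b) * t ^ q * Real.exp (-(t * r ^ 2)) * r⁻¹ ^ b := by
          rw [pow_add, inv_pow]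
          field_simp
      _ ≤ (2 ^ N * N.factorial * Real.exp (t * r ^ 2 / 2)) *
            (Real.exp (-(t * r ^ 2 / 2)) * Real.exp (-t / 2)) * r⁻¹ ^ b := by
          refine mul_le_mul_of_nonneg_right ?_ (by positivity)
          exact mul_le_mul (hpow.trans hexp) hsplit (Real.exp_pos _).le (by positivity)
      _ = 2 ^ N * N.factorial * (Real.exp (t * r ^ 2 / 2) * Real.exp (-(t * r ^ 2 / 2))) *
            (Real.exp (-t / 2) * r⁻¹ ^ b) := by ring
      _ = 2 ^ N * N.factorial * (Real.exp (-t / 2) * r⁻¹ ^ b) := by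
          rw [← Real.exp_add, add_neg_cancel, Real.exp_zero, mul_one]

/-- High-frequency bound for the diffusive part `D2`. -/
theorem exists_bound_D2 (b l : ℕ) :
    ∃ C : ℝ, 0 ≤ C ∧ ∀ r t : ℝ, 1 ≤ r → 1 ≤ t →
      |D2 l r t| ≤ C * (Real.exp (-t / 2) * r⁻¹ ^ b) := by
  obtain ⟨F, hF0, hmem, hF⟩ := exists_seq_hasDerivAt (fun _ => Submodule.span ℝ heatTerms)
    (fun r => {a : ℝ | 0 < 1 - 4 * a * r ^ 2}) (fun _ => exists_hasDerivAt_heatTerms)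
    (heatTerm 0 0 1 0) (Submodule.subset_span ⟨0, 0, 1, 0, rfl⟩)
  choose C hC hbd using fun k => exists_bound_heatTerms b (hmem k)
  refine ⟨∑ k ∈ Finset.range l, 1 / (k.factorial : ℝ) * C k,
    Finset.sum_nonneg fun k _ => mul_nonneg (by positivity) (hC k), fun r t hr ht => ?_⟩
  have hh : (fun a => hDW r a t) = F 0 r t := by
    ext a
    simp [hF0, heatTerm, hDW]
  have hopen : IsOpen {a : ℝ | 0 < 1 - 4 * a * r ^ 2} :=
    isOpen_lt continuous_const (by fun_prop)
  have hiter : ∀ k, iteratedDeriv k (fun a => hDW r a t) 0 = F k r t 0 := fun k => by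
    rw [hh]
    exact iteratedDeriv_eq_of_hasDerivAt hopen (fun k => F k r t) (fun k => hF k r t) k 0
      (by simp)
  simp only [D2, hiter]
  rw [Finset.sum_mul]
  refine (Finset.abs_sum_le_sum_abs _ _).trans (Finset.sum_le_sum fun k _ => ?_)
  rw [abs_mul, abs_of_nonneg (show (0 : ℝ) ≤ 1 / (k.factorial : ℝ) by positivity), mul_assoc]
  exact mul_le_mul_of_nonneg_left (hbd k r t 0 ⟨hr, ht, rfl⟩) (by positivity)

/-- Pointwise high-frequency bound. -/
theorem exists_bound_K1_sub_W2_sub_D2 (b l : ℕ) :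
    ∃ C : ℝ, 0 ≤ C ∧ ∀ r t : ℝ, 1 ≤ r → 1 ≤ t →
      |K1 t r - Real.exp (-t / 2) * W2 (b + 1) r t - D2 l r t|
        ≤ C * (t ^ b * Real.exp (-t / 2) * r⁻¹ ^ (b + 1)) := by
  obtain ⟨C₁, hC₁, h₁⟩ := exists_bound_sin_div_sub_W2 b
  obtain ⟨C₂, hC₂, h₂⟩ := exists_bound_D2 (b + 1) l
  refine ⟨C₁ + C₂, by positivity, fun r t hr ht => ?_⟩
  have hK : K1 t r = Real.exp (-t / 2) *
      (Real.sin (t * Real.sqrt (r ^ 2 - 1 / 4)) / Real.sqrt (r ^ 2 - 1 / 4)) := by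
    rw [K1, if_neg (by linarith), if_neg (by linarith), mul_div_assoc]
  have hpos : 0 ≤ Real.exp (-t / 2) * r⁻¹ ^ (b + 1) := by positivity
  have h₂' : |D2 l r t| ≤ C₂ * (t ^ b * (Real.exp (-t / 2) * r⁻¹ ^ (b + 1))) :=
    (h₂ r t hr ht).trans (mul_le_mul_of_nonneg_left
      (le_mul_of_one_le_left hpos (one_le_pow₀ ht)) hC₂)
  rw [hK, ← mul_sub]
  refine (abs_sub _ _).trans ?_
  rw [abs_mul, Real.abs_exp]
  calc _ ≤ Real.exp (-t / 2) * (C₁ * (t ^ b * r⁻¹ ^ (b + 1))) +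
        C₂ * (t ^ b * (Real.exp (-t / 2) * r⁻¹ ^ (b + 1))) :=
        add_le_add (mul_le_mul_of_nonneg_left (h₁ r t hr ht) (Real.exp_pos _).le) h₂'
    _ = _ := by ring

theorem eLpNorm_two_inv_one_add_norm_pow_lt_top {n b : ℕ} (hb : (n : ℝ) / 2 < b) :
    eLpNorm (fun ξ : EuclideanSpace ℝ (Fin n) => ((1 + ‖ξ‖)⁻¹) ^ b) 2 volume < ⊤ := by
  have hint : Integrable (fun ξ : EuclideanSpace ℝ (Fin n) => (1 + ‖ξ‖) ^ (-((2 * b : ℕ) : ℝ))) :=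
    integrable_one_add_norm (by
      rw [finrank_euclideanSpace_fin]
      push_cast
      linarith)
  have hmeas : AEStronglyMeasurable
      (fun ξ : EuclideanSpace ℝ (Fin n) => ((1 + ‖ξ‖)⁻¹) ^ b) volume :=
    (by fun_prop : Measurable fun ξ : EuclideanSpace ℝ (Fin n) =>
      ((1 + ‖ξ‖)⁻¹) ^ b).aestronglyMeasurable
  refine ((memLp_two_iff_integrable_sq hmeas).2 (hint.congr (Filter.Eventually.of_forall ?_))).2
  intro ξ
  have : 0 ≤ 1 + ‖ξ‖ := by positivity
  simp only
  rw [Real.rpow_neg this, Real.rpow_natCast, ← pow_mul, inv_pow, mul_comm b 2]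

/-- High-frequency estimate for `m²_{b,ℓ,H}`: `‖m²_{b,ℓ,H}(·,t)‖₂ ≤ C t^{b−1} e^{−t/2}`. -/
theorem stmt_2 (n b l : ℕ) (hn : 1 ≤ n) (hb : (n : ℝ) / 2 < (b : ℝ)) (hl : 1 ≤ l)
    (χL χH : ℝ → ℝ) (hχLsmooth : ContDiff ℝ (⊤ : ℕ∞) χL) (hχHsmooth : ContDiff ℝ (⊤ : ℕ∞) χH)
    (hχL0 : ∀ r : ℝ, 0 ≤ χL r) (hχL1 : ∀ r : ℝ, χL r ≤ 1)
    (hχH0 : ∀ r : ℝ, 0 ≤ χH r) (hχH1 : ∀ r : ℝ, χH r ≤ 1)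
    (hχLone : ∀ r : ℝ, r ≤ 1/4 → χL r = 1) (hχLzero : ∀ r : ℝ, 1/3 ≤ r → χL r = 0)
    (hχHzero : ∀ r : ℝ, r ≤ 1 → χH r = 0) (hχHone : ∀ r : ℝ, 2 ≤ r → χH r = 1) :
    ∃ C : ℝ, 0 < C ∧ ∀ t : ℝ, 1 ≤ t →
      eLpNorm
        (fun ξ : EuclideanSpace ℝ (Fin n) =>
          χH ‖ξ‖ * (K1 t ‖ξ‖ - Real.exp (-t/2) * W2 b ‖ξ‖ t - D2 l ‖ξ‖ t)) 2 volume
      ≤ ENNReal.ofReal (C * t ^ ((b : ℝ) - 1) * Real.exp (-t/2)) := by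
  obtain ⟨b, rfl⟩ : ∃ b', b = b' + 1 :=
    Nat.exists_eq_succ_of_ne_zero (by
      rintro rfl
      have : (0 : ℝ) ≤ (n : ℝ) / 2 := by positivity
      norm_num at hb
      linarith)
  obtain ⟨C, hC, hbd⟩ := exists_bound_K1_sub_W2_sub_D2 b l
  have hfin := eLpNorm_two_inv_one_add_norm_pow_lt_top hb
  set I := eLpNorm (fun ξ : EuclideanSpace ℝ (Fin n) => ((1 + ‖ξ‖)⁻¹) ^ (b + 1)) 2 volume
  refine ⟨C * 2 ^ (b + 1) * I.toReal + 1, by positivity, fun t ht => ?_⟩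
  have ht0 : 0 < t := by linarith
  set A := C * 2 ^ (b + 1) * (t ^ b * Real.exp (-t / 2)) with hA
  have hA0 : 0 ≤ A := by positivity
  have hpt : ∀ ξ : EuclideanSpace ℝ (Fin n),
      ‖χH ‖ξ‖ * (K1 t ‖ξ‖ - Real.exp (-t/2) * W2 (b + 1) ‖ξ‖ t - D2 l ‖ξ‖ t)‖
        ≤ A * ‖((1 + ‖ξ‖)⁻¹) ^ (b + 1)‖ := by
    intro ξ
    rcases le_total ‖ξ‖ 1 with h | h
    · rw [hχHzero _ h, zero_mul, norm_zero]
      positivity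
    · have hξ : 0 < ‖ξ‖ := by linarith
      have hinv : ‖ξ‖⁻¹ ≤ 2 * (1 + ‖ξ‖)⁻¹ := by
        rw [← div_eq_mul_inv, inv_eq_one_div, div_le_div_iff₀ hξ (by positivity)]
        linarith
      rw [Real.norm_eq_abs, Real.norm_eq_abs, abs_mul, abs_of_nonneg (hχH0 _),
        abs_of_nonneg (show 0 ≤ ((1 + ‖ξ‖)⁻¹) ^ (b + 1) by positivity)]
      calc _ ≤ |K1 t ‖ξ‖ - Real.exp (-t/2) * W2 (b + 1) ‖ξ‖ t - D2 l ‖ξ‖ t| :=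
            mul_le_of_le_one_left (abs_nonneg _) (hχH1 _)
        _ ≤ C * (t ^ b * Real.exp (-t / 2) * ‖ξ‖⁻¹ ^ (b + 1)) := hbd _ t h ht
        _ ≤ C * (t ^ b * Real.exp (-t / 2) * (2 * (1 + ‖ξ‖)⁻¹) ^ (b + 1)) := by gcongr
        _ = A * ((1 + ‖ξ‖)⁻¹) ^ (b + 1) := by
            rw [hA, mul_pow]
            ring
  refine (eLpNorm_le_mul_eLpNorm_of_ae_le_mul (Filter.Eventually.of_forall hpt) 2).trans ?_
  change ENNReal.ofReal A * I ≤ _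
  have hI : ENNReal.ofReal A * I = ENNReal.ofReal (A * I.toReal) := by
    rw [ENNReal.ofReal_mul hA0, ENNReal.ofReal_toReal hfin.ne]
  rw [hI]
  refine ENNReal.ofReal_le_ofReal ?_
  have hpow : t ^ (((b + 1 : ℕ) : ℝ) - 1) = t ^ b := by
    rw [Nat.cast_succ, add_sub_cancel_right, Real.rpow_natCast]
  rw [hpow]
  have : 0 ≤ t ^ b * Real.exp (-t / 2) := by positivity
  rw [hA]
  linarith
end

section
/- Let n ∈ ℕ, b ∈ ℕ and ℓ ∈ ℕ. Then there exists a constant C > 0, independent of t, such that ‖m¹_{b,ℓ,L}(·,t)‖₂ ≤ C t^{2(b−1)} e^{−t/2} + C t^{−n/4−ℓ} for all t ≥ 1. -/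
open MeasureTheory

open Filter Topology

/-- Iterated derivatives of the real restriction of a function holomorphic near a real point. -/
lemma iteratedDeriv_re_of_analyticAt (k : ℕ) {f : ℂ → ℂ} {g : ℝ → ℝ} {x : ℝ}
    (hf : AnalyticAt ℂ f x) (hg : g =ᶠ[𝓝 x] fun y : ℝ => (f y).re) :
    iteratedDeriv k g x = (iteratedDeriv k f x).re := by
  induction k generalizing f g with
  | zero => simpa using hg.eq_of_nhds
  | succ k ih =>
    rw [iteratedDeriv_succ', iteratedDeriv_succ']
    refine ih hf.deriv (hg.deriv.trans ?_)
    have hev : ∀ᶠ y : ℝ in 𝓝 x, AnalyticAt ℂ f y :=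
      Complex.continuous_ofReal.continuousAt.eventually hf.eventually_analyticAt
    filter_upwards [hev] with y hy
    exact hy.differentiableAt.hasDerivAt.real_of_complex.deriv

/-- Taylor remainder at `1` for a function holomorphic and bounded on a disc of radius `R ≥ 2`. -/
lemma norm_sub_taylor_le {f : ℂ → ℂ} {R M : ℝ} (hR : 2 ≤ R)
    (hf : DiffContOnCl ℂ f (Metric.ball 0 R)) (hM : ∀ z ∈ Metric.sphere (0 : ℂ) R, ‖f z‖ ≤ M)
    (l : ℕ) :
    ‖f 1 - ∑ k ∈ Finset.range l, (1 / (k.factorial : ℂ)) * iteratedDeriv k f 0‖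
      ≤ 2 * M * R⁻¹ ^ l := by
  have hR0 : 0 < R := by linarith
  have hsum := Complex.hasSum_taylorSeries_on_ball hf.differentiableOn
    (z := 1) (by simp; linarith)
  simp only [sub_zero, one_pow, one_mul, smul_eq_mul] at hsum
  have hterm (k : ℕ) : ‖((k.factorial : ℂ))⁻¹ * iteratedDeriv k f 0‖ ≤ M * R⁻¹ ^ k := by
    have h := Complex.norm_iteratedDeriv_le_of_forall_mem_sphere_norm_le k hR0 hf hM
    rw [norm_mul, norm_inv, Complex.norm_natCast]
    have hk : (0 : ℝ) < k.factorial := by positivity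
    calc _ ≤ (k.factorial : ℝ)⁻¹ * (k.factorial * M / R ^ k) := by gcongr
      _ = M * R⁻¹ ^ k := by rw [inv_pow]; field_simp
  have hM0 : 0 ≤ M := by
    have := (norm_nonneg _).trans (hterm 0)
    simpa using this
  have hq : R⁻¹ ≤ 1 / 2 := by
    rw [inv_le_comm₀ hR0 (by norm_num)]; norm_num; exact hR
  have hq0 : 0 ≤ R⁻¹ := by positivity
  have hgeo := ((hasSum_geometric_of_lt_one hq0 (by linarith)).mul_left (M * R⁻¹ ^ l))
  have hsplit := hsum.summable.sum_add_tsum_nat_add l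
  rw [hsum.tsum_eq] at hsplit
  simp only [one_div]
  rw [← hsplit, add_sub_cancel_left]
  refine (tsum_of_norm_bounded hgeo fun i => ?_).trans ?_
  · refine (hterm _).trans (le_of_eq ?_)
    ring
  · have h1 : (1 - R⁻¹)⁻¹ ≤ 2 := by
      rw [inv_le_comm₀ (by linarith) (by norm_num)]; linarith
    have h2 : 0 ≤ M * R⁻¹ ^ l := by positivity
    nlinarith

/-- The entire function `F` with `F (w ^ 2) = cos w`. -/
noncomputable def cosSqrt (z : ℂ) : ℂ := ∑' k : ℕ, (-1) ^ k * z ^ k / ((2 * k).factorial : ℂ)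

lemma cosSqrt_sq (w : ℂ) : cosSqrt (w ^ 2) = Complex.cos w := by
  rw [← (Complex.hasSum_cos w).tsum_eq, cosSqrt]
  simp only [pow_mul]

lemma differentiable_cosSqrt : Differentiable ℂ cosSqrt := by
  intro z
  have h : DifferentiableOn ℂ cosSqrt (Metric.ball 0 (‖z‖ + 1)) := by
    refine Complex.differentiableOn_tsum_of_summable_norm
      (Real.summable_pow_div_factorial (‖z‖ + 1)) (fun i => ?_) Metric.isOpen_ball
      fun i w hw => ?_
    · fun_prop
    · have hw' : ‖w‖ ≤ ‖z‖ + 1 := by simpa using (Metric.mem_ball.1 hw).le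
      rw [norm_div, norm_mul, norm_pow, norm_pow, norm_neg, norm_one, one_pow, one_mul,
        Complex.norm_natCast]
      gcongr
      omega
  exact h.differentiableAt (Metric.isOpen_ball.mem_nhds (by simp))

lemma norm_cos_le_exp_abs_im (w : ℂ) : ‖Complex.cos w‖ ≤ Real.exp |w.im| := by
  rw [Complex.cos, norm_div]
  have h1 : ‖Complex.exp (w * Complex.I)‖ ≤ Real.exp |w.im| := by
    rw [Complex.norm_exp]
    simpa using neg_le_abs w.im
  have h2 : ‖Complex.exp (-w * Complex.I)‖ ≤ Real.exp |w.im| := by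
    rw [Complex.norm_exp]
    simpa using le_abs_self w.im
  have h3 := norm_add_le (Complex.exp (w * Complex.I)) (Complex.exp (-w * Complex.I))
  rw [Complex.norm_ofNat]
  linarith

lemma norm_cosSqrt_le {z : ℂ} {y : ℝ} (hy : 0 ≤ y) (hz : ‖z - y‖ ≤ 1) :
    ‖cosSqrt z‖ ≤ Real.exp 2 := by
  obtain ⟨w, rfl⟩ : ∃ w : ℂ, w ^ 2 = z :=
    ⟨z ^ ((2 : ℕ) : ℂ)⁻¹, Complex.cpow_nat_inv_pow z two_ne_zero⟩
  rw [cosSqrt_sq]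
  refine (norm_cos_le_exp_abs_im w).trans (Real.exp_le_exp.2 ?_)
  have hre := (abs_le.1 ((Complex.abs_re_le_norm _).trans hz)).1
  have him := (Complex.abs_im_le_norm _).trans hz
  simp [pow_two] at hre him
  have him2 := abs_le.1 him
  have hsq : (w.re * w.im + w.im * w.re) ^ 2 ≤ 1 := by nlinarith
  refine abs_le_of_sq_le_sq ?_ (by norm_num)
  nlinarith [sq_nonneg w.re, sq_nonneg w.im, mul_nonneg (sq_nonneg w.re) (sq_nonneg w.im)]

lemma abs_iteratedDeriv_fDW_le (k : ℕ) {r t : ℝ} (hr : 0 < r) (ht : 0 < t) :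
    |iteratedDeriv k (fun c => fDW r c t) 0| ≤ k.factorial * Real.exp 2 * t ^ (2 * k) := by
  set f : ℂ → ℂ := fun c => cosSqrt (t ^ 2 * (r ^ 2 - c)) with hf
  have hdiff : Differentiable ℂ f := by
    refine differentiable_cosSqrt.comp ?_
    fun_prop
  have heq : (fun c => fDW r c t) =ᶠ[𝓝 0] fun y : ℝ => (f y).re := by
    filter_upwards [eventually_le_nhds (show (0 : ℝ) < r ^ 2 by positivity)] with c hc
    have : (t ^ 2 * (r ^ 2 - c) : ℂ) = ((t * √(r ^ 2 - c) : ℝ) : ℂ) ^ 2 := by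
      norm_cast
      rw [mul_pow, Real.sq_sqrt (by linarith)]
    simp only [hf, this, cosSqrt_sq, fDW]
    rw [← Complex.ofReal_cos, Complex.ofReal_re]
  rw [iteratedDeriv_re_of_analyticAt k (f := f) (hdiff.analyticAt _) heq]
  refine (Complex.abs_re_le_norm _).trans ?_
  have hR : 0 < (t ^ 2)⁻¹ := by positivity
  have h := Complex.norm_iteratedDeriv_le_of_forall_mem_sphere_norm_le (c := 0) (C := Real.exp 2)
    k hR hdiff.diffContOnCl fun z hz => by
      refine norm_cosSqrt_le (y := t ^ 2 * r ^ 2) (by positivity) ?_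
      have : (t ^ 2 * (r ^ 2 - z) : ℂ) - ((t ^ 2 * r ^ 2 : ℝ) : ℂ) = -((t ^ 2 : ℝ) * z) := by
        push_cast; ring
      rw [this, norm_neg, norm_mul, mem_sphere_zero_iff_norm.1 hz, Complex.norm_real]
      rw [Real.norm_of_nonneg (by positivity), mul_inv_cancel₀ (by positivity)]
  refine h.trans (le_of_eq ?_)
  rw [inv_pow, div_inv_eq_mul, pow_mul]

lemma ofReal_sqrt_eq_cpow {x : ℝ} (hx : 0 ≤ x) : ((√x : ℝ) : ℂ) = (x : ℂ) ^ (2⁻¹ : ℂ) := by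
  rw [Real.sqrt_eq_rpow, Complex.ofReal_cpow hx]
  norm_num

/-- Holomorphic extension of `a ↦ gDW r a t`. -/
noncomputable def gDWExt (r t : ℝ) (a : ℂ) : ℂ :=
  Complex.exp (-(2 * t * r ^ 2) / (1 + (1 - 4 * a * r ^ 2) ^ (2⁻¹ : ℂ)))

lemma ofReal_gDW {r a t : ℝ} (h : 0 ≤ 1 - 4 * a * r ^ 2) :
    ((gDW r a t : ℝ) : ℂ) = gDWExt r t a := by
  rw [gDW, gDWExt]
  push_cast
  rw [ofReal_sqrt_eq_cpow h]
  push_cast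
  rfl

lemma one_le_re_one_add_cpow (z : ℂ) : 1 ≤ (1 + z ^ (2⁻¹ : ℂ)).re := by
  rw [Complex.add_re, Complex.one_re, Complex.cpow_inv_two_re]
  have := Real.sqrt_nonneg ((‖z‖ + z.re) / 2)
  linarith

lemma norm_cpow_inv_two_sq (z : ℂ) : ‖z ^ (2⁻¹ : ℂ)‖ ^ 2 = ‖z‖ := by
  have h : (z ^ (2⁻¹ : ℂ)) ^ 2 = z := by
    simp
  rw [← norm_pow, h]

lemma differentiableAt_gDWExt {r t : ℝ} {a : ℂ} (h : ‖4 * a * r ^ 2‖ < 1) :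
    DifferentiableAt ℂ (gDWExt r t) a := by
  have hne : (1 + (1 - 4 * a * r ^ 2) ^ (2⁻¹ : ℂ)) ≠ 0 := fun h0 => by
    have := one_le_re_one_add_cpow (1 - 4 * a * r ^ 2)
    rw [h0] at this
    norm_num at this
  have hslit : (1 - 4 * a * r ^ 2) ∈ Complex.slitPlane := by
    left
    have := (Complex.re_le_norm (4 * a * r ^ 2)).trans_lt h
    rw [Complex.sub_re, Complex.one_re]
    linarith
  unfold gDWExt
  refine DifferentiableAt.cexp (DifferentiableAt.div (by fun_prop) ?_ hne)
  refine DifferentiableAt.const_add _ (DifferentiableAt.cpow (by fun_prop) (by fun_prop) hslit)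

lemma norm_gDWExt_le {r t : ℝ} (ht : 0 ≤ t) {a : ℂ} (h : ‖4 * a * r ^ 2‖ ≤ 1) :
    ‖gDWExt r t a‖ ≤ Real.exp (-(2 / 9 * t * r ^ 2)) := by
  rw [gDWExt, Complex.norm_exp, Real.exp_le_exp]
  set w := 1 + (1 - 4 * a * r ^ 2) ^ (2⁻¹ : ℂ) with hw
  have hre : 1 ≤ w.re := one_le_re_one_add_cpow _
  have hs : ‖(1 - 4 * a * r ^ 2) ^ (2⁻¹ : ℂ)‖ ≤ 2 := by
    have h1 := norm_cpow_inv_two_sq (1 - 4 * a * r ^ 2)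
    have h2 := norm_sub_le (1 : ℂ) (4 * a * r ^ 2)
    rw [norm_one] at h2
    have h3 := norm_nonneg ((1 - 4 * a * r ^ 2) ^ (2⁻¹ : ℂ))
    nlinarith
  have hnorm : ‖w‖ ≤ 3 := by
    have := norm_add_le (1 : ℂ) ((1 - 4 * a * r ^ 2) ^ (2⁻¹ : ℂ))
    rw [norm_one, ← hw] at this
    linarith
  have hn1 : 1 ≤ ‖w‖ := hre.trans (Complex.re_le_norm w)
  have hcast : (-(2 * t * r ^ 2) / w : ℂ) = ((-(2 * t * r ^ 2) : ℝ) : ℂ) * w⁻¹ := by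
    push_cast
    rw [div_eq_mul_inv]
  rw [hcast, Complex.re_ofReal_mul, Complex.inv_re, Complex.normSq_eq_norm_sq]
  have h9 : 1 / 9 ≤ w.re / ‖w‖ ^ 2 := by
    rw [div_le_div_iff₀ (by norm_num) (by positivity)]
    nlinarith
  have : 0 ≤ t * r ^ 2 := by positivity
  nlinarith

lemma abs_gDW_sub_taylor_le (l : ℕ) {r t : ℝ} (hr0 : 0 < r) (hr : r ≤ 1 / 3) (ht : 0 ≤ t) :
    |gDW r 1 t - ∑ k ∈ Finset.range l,
      (1 / (k.factorial) : ℝ) * iteratedDeriv k (fun a => gDW r a t) 0|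
      ≤ 2 * Real.exp (-(2 / 9 * t * r ^ 2)) * (9 / 2 * r ^ 2) ^ l := by
  have hr2 : r ^ 2 ≤ 1 / 9 := by nlinarith
  set R : ℝ := (9 / 2 * r ^ 2)⁻¹ with hRdef
  have hR : 2 ≤ R := by
    rw [hRdef, le_inv_comm₀ (by norm_num) (by positivity)]
    linarith
  have hRr : 4 * R * r ^ 2 = 8 / 9 := by
    rw [hRdef]
    field_simp
    norm_num
  have hnorm (a : ℂ) : ‖4 * a * r ^ 2‖ = 4 * ‖a‖ * r ^ 2 := by
    simp
  have hdiff : DifferentiableOn ℂ (gDWExt r t) (closure (Metric.ball 0 R)) := fun a ha => by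
    rw [closure_ball _ (by positivity), mem_closedBall_zero_iff] at ha
    refine (differentiableAt_gDWExt ?_).differentiableWithinAt
    rw [hnorm]
    have : 4 * ‖a‖ * r ^ 2 ≤ 4 * R * r ^ 2 := by gcongr
    linarith
  have key := norm_sub_taylor_le hR hdiff.diffContOnCl
    (M := Real.exp (-(2 / 9 * t * r ^ 2))) (fun a ha => norm_gDWExt_le ht (by
      rw [hnorm, mem_sphere_zero_iff_norm.1 ha]; linarith)) l
  have han : AnalyticAt ℂ (gDWExt r t) ((0 : ℝ) : ℂ) :=
    (hdiff.mono subset_closure).analyticAt (Metric.ball_mem_nhds _ (by positivity))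
  have heq : (fun a => gDW r a t) =ᶠ[𝓝 0] fun a : ℝ => (gDWExt r t a).re := by
    filter_upwards [eventually_le_nhds (show (0 : ℝ) < 1 by norm_num)] with a ha
    rw [← ofReal_gDW (by nlinarith), Complex.ofReal_re]
  have hone : gDW r 1 t = (gDWExt r t 1).re := by
    have := ofReal_gDW (r := r) (a := 1) (t := t) (by nlinarith)
    rw [Complex.ofReal_one] at this
    rw [← this, Complex.ofReal_re]
  have hterm (k : ℕ) : (1 / (k.factorial) : ℝ) * iteratedDeriv k (fun a => gDW r a t) 0
      = ((1 / (k.factorial : ℂ)) * iteratedDeriv k (gDWExt r t) 0).re := by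
    have hc : (1 / (k.factorial : ℂ)) = ((1 / (k.factorial) : ℝ) : ℂ) := by push_cast; rfl
    rw [hc, Complex.re_ofReal_mul, iteratedDeriv_re_of_analyticAt k han heq, Complex.ofReal_zero]
  simp only [hterm]
  rw [hone, ← Complex.re_sum, ← Complex.sub_re]
  refine (Complex.abs_re_le_norm _).trans (key.trans (le_of_eq ?_))
  rw [hRdef, inv_inv]

lemma K0_eq {r t : ℝ} (hr0 : 0 ≤ r) (hr : r ≤ 1 / 2) :
    K0 t r = 1 / 2 * gDW r 1 t
      + 1 / 2 * (Real.exp (-t / 2) * Real.exp (-(t * √(1 / 4 - r ^ 2)))) := by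
  have hs : √(1 - 4 * 1 * r ^ 2) = 2 * √(1 / 4 - r ^ 2) := by
    rw [show (1 - 4 * 1 * r ^ 2 : ℝ) = 2 ^ 2 * (1 / 4 - r ^ 2) by ring,
      Real.sqrt_mul (by norm_num), Real.sqrt_sq (by norm_num)]
  have hsq : √(1 / 4 - r ^ 2) ^ 2 = 1 / 4 - r ^ 2 := Real.sq_sqrt (by nlinarith)
  have hs0 := Real.sqrt_nonneg (1 / 4 - r ^ 2)
  have hexp : -(2 * t * r ^ 2) / (1 + 2 * √(1 / 4 - r ^ 2)) = -t / 2 + t * √(1 / 4 - r ^ 2) := by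
    rw [div_eq_iff (by positivity)]
    linear_combination (-2 * t) * hsq
  rw [K0, if_pos hr, gDW, hs, hexp, Real.exp_add, Real.cosh_eq]
  ring

lemma abs_W1_le (b : ℕ) (hb : 1 ≤ b) {r t : ℝ} (hr : 0 < r) (ht : 1 ≤ t) :
    |W1 b r t| ≤ b * Real.exp 2 * t ^ (2 * (b - 1)) := by
  rw [W1]
  refine (Finset.abs_sum_le_sum_abs _ _).trans ?_
  have : ∀ k ∈ Finset.range b, |(1 / 4 : ℝ) ^ k * (1 / (k.factorial) : ℝ)
      * iteratedDeriv k (fun c => fDW r c t) 0| ≤ Real.exp 2 * t ^ (2 * (b - 1)) := by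
    intro k hk
    have hk' : k ≤ b - 1 := by have := Finset.mem_range.1 hk; omega
    have h1 : (1 / 4 : ℝ) ^ k ≤ 1 := pow_le_one₀ (by norm_num) (by norm_num)
    rw [abs_mul, abs_of_nonneg (by positivity)]
    calc _ ≤ 1 * (1 / (k.factorial) : ℝ) * (k.factorial * Real.exp 2 * t ^ (2 * k)) := by
          gcongr
          exact abs_iteratedDeriv_fDW_le k hr (by linarith)
      _ = Real.exp 2 * t ^ (2 * k) := by field_simp
      _ ≤ _ := by gcongr
  refine (Finset.sum_le_sum this).trans (le_of_eq ?_)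
  simp [mul_assoc]

lemma abs_lowFreq_le (b l : ℕ) (hb : 1 ≤ b) {r t : ℝ} (hr0 : 0 < r) (hr : r ≤ 1 / 3)
    (ht : 1 ≤ t) :
    |K0 t r - Real.exp (-t / 2) * W1 b r t - D1 l r t|
      ≤ (1 + b * Real.exp 2) * t ^ (2 * (b - 1)) * Real.exp (-t / 2)
        + (9 / 2 * r ^ 2) ^ l * Real.exp (-(2 / 9 * t * r ^ 2)) := by
  have hW := abs_W1_le b hb hr0 ht
  have hg := abs_gDW_sub_taylor_le l hr0 hr (t := t) (by linarith)
  have hE := Real.exp_pos (-t / 2)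
  have hs : Real.exp (-(t * √(1 / 4 - r ^ 2))) ≤ 1 := by
    rw [Real.exp_le_one_iff]
    have : 0 ≤ t * √(1 / 4 - r ^ 2) := by positivity
    linarith
  have hp : 1 ≤ t ^ (2 * (b - 1)) := one_le_pow₀ ht
  rw [K0_eq hr0.le (by linarith), D1]
  set S := ∑ k ∈ Finset.range l, (1 / (k.factorial) : ℝ) * iteratedDeriv k (fun a => gDW r a t) 0
  set E := Real.exp (-t / 2)
  set s := Real.exp (-(t * √(1 / 4 - r ^ 2))) with hsdef
  have hs0 : 0 < s := Real.exp_pos _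
  have hEs : E * s ≤ E * t ^ (2 * (b - 1)) := by
    gcongr
    exact hs.trans hp
  have hEs0 : 0 < E * s := by positivity
  have hEW : |E * W1 b r t| ≤ E * (b * Real.exp 2 * t ^ (2 * (b - 1))) := by
    rw [abs_mul, abs_of_pos hE]
    gcongr
  rw [abs_le] at hg hEW ⊢
  constructor <;> linarith [hg.1, hg.2, hEW.1, hEW.2]

/-- Half of an exponential decay absorbs a power. -/
lemma pow_mul_exp_neg_le (l : ℕ) {y : ℝ} (hy : 0 ≤ y) :
    y ^ l * Real.exp (-(2 * y)) ≤ l.factorial * Real.exp (-y) := by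
  have h := Real.pow_div_factorial_le_exp y hy l
  rw [div_le_iff₀ (by positivity)] at h
  calc _ ≤ Real.exp y * l.factorial * Real.exp (-(2 * y)) := by gcongr
    _ = l.factorial * (Real.exp y * Real.exp (-(2 * y))) := by ring
    _ = _ := by
      rw [← Real.exp_add]
      ring_nf

lemma remainder_le (l : ℕ) (r : ℝ) {t : ℝ} (ht : 0 < t) :
    (9 / 2 * r ^ 2) ^ l * Real.exp (-(2 / 9 * t * r ^ 2))
      ≤ (81 / 2 / t) ^ l * l.factorial * Real.exp (-(t / 9) * r ^ 2) := by
  have h := pow_mul_exp_neg_le l (y := t / 9 * r ^ 2) (by positivity)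
  have h1 : (9 / 2 * r ^ 2) ^ l = (81 / 2 / t) ^ l * (t / 9 * r ^ 2) ^ l := by
    rw [← mul_pow]
    congr 1
    field_simp
    ring
  have h2 : -(2 / 9 * t * r ^ 2) = -(2 * (t / 9 * r ^ 2)) := by ring
  rw [h1, h2, mul_assoc, mul_assoc, neg_mul]
  gcongr

lemma eLpNorm_two_gaussian (n : ℕ) {c : ℝ} (hc : 0 < c) :
    eLpNorm (fun ξ : EuclideanSpace ℝ (Fin n) => Real.exp (-c * ‖ξ‖ ^ 2)) 2 volume
      = ENNReal.ofReal ((Real.pi / (2 * c)) ^ ((n : ℝ) / 4)) := by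
  have hsq (ξ : EuclideanSpace ℝ (Fin n)) :
      Real.exp (-c * ‖ξ‖ ^ 2) ^ 2 = Real.exp (-(2 * c) * ‖ξ‖ ^ 2) := by
    rw [← Real.exp_nat_mul]
    push_cast
    ring_nf
  have hint : ∫ ξ : EuclideanSpace ℝ (Fin n), Real.exp (-(2 * c) * ‖ξ‖ ^ 2)
      = (Real.pi / (2 * c)) ^ ((n : ℝ) / 2) := by
    rw [GaussianFourier.integral_rexp_neg_mul_sq_norm (by positivity)]
    simp
  have hmem : MemLp (fun ξ : EuclideanSpace ℝ (Fin n) => Real.exp (-c * ‖ξ‖ ^ 2)) 2 volume := by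
    rw [memLp_two_iff_integrable_sq (by fun_prop)]
    simp only [hsq]
    refine Integrable.of_integral_ne_zero ?_
    rw [hint]
    positivity
  rw [hmem.eLpNorm_eq_integral_rpow_norm (by norm_num) (by norm_num)]
  simp only [ENNReal.toReal_ofNat, Real.rpow_ofNat, Real.norm_of_nonneg (Real.exp_pos _).le, hsq]
  rw [hint, ← Real.rpow_mul (by positivity)]
  ring_nf

/-- Low-frequency estimate for `m¹_{b,ℓ,L}`:
`‖m¹_{b,ℓ,L}(·,t)‖₂ ≤ C t^{2(b−1)} e^{−t/2} + C t^{−n/4−ℓ}`. -/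
theorem stmt_3 (n b l : ℕ) (hn : 1 ≤ n) (hb : 1 ≤ b) (hl : 1 ≤ l)
    (χL χH : ℝ → ℝ) (hχLsmooth : ContDiff ℝ (⊤ : ℕ∞) χL) (hχHsmooth : ContDiff ℝ (⊤ : ℕ∞) χH)
    (hχL0 : ∀ r : ℝ, 0 ≤ χL r) (hχL1 : ∀ r : ℝ, χL r ≤ 1)
    (hχH0 : ∀ r : ℝ, 0 ≤ χH r) (hχH1 : ∀ r : ℝ, χH r ≤ 1)
    (hχLone : ∀ r : ℝ, r ≤ 1/4 → χL r = 1) (hχLzero : ∀ r : ℝ, 1/3 ≤ r → χL r = 0)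
    (hχHzero : ∀ r : ℝ, r ≤ 1 → χH r = 0) (hχHone : ∀ r : ℝ, 2 ≤ r → χH r = 1) :
    ∃ C : ℝ, 0 < C ∧ ∀ t : ℝ, 1 ≤ t →
      eLpNorm
        (fun ξ : EuclideanSpace ℝ (Fin n) =>
          χL ‖ξ‖ * (K0 t ‖ξ‖ - Real.exp (-t/2) * W1 b ‖ξ‖ t - D1 l ‖ξ‖ t)) 2 volume
      ≤ ENNReal.ofReal (C * t ^ (2 * ((b : ℝ) - 1)) * Real.exp (-t/2)
          + C * t ^ (-(n : ℝ)/4 - (l : ℝ))) := by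
  set B := Metric.closedBall (0 : EuclideanSpace ℝ (Fin n)) (1 / 3)
  set V : ℝ := (volume B ^ (1 / (2 : ENNReal).toReal)).toReal with hV
  have hVfin : volume B ^ (1 / (2 : ENNReal).toReal) ≠ ⊤ :=
    ENNReal.rpow_ne_top_of_nonneg (by positivity) measure_closedBall_lt_top.ne
  set A : ℝ := 1 + b * Real.exp 2
  set G : ℝ := (81 / 2) ^ l * l.factorial * (9 * Real.pi / 2) ^ ((n : ℝ) / 4)
  refine ⟨A * V + G, by positivity, fun t ht => ?_⟩
  have ht0 : 0 < t := by linarith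
  set P : ℝ := t ^ (2 * (b - 1)) * Real.exp (-t / 2) with hP
  set D : ℝ := (81 / 2 / t) ^ l * l.factorial
  have hPr : t ^ (2 * ((b : ℝ) - 1)) * Real.exp (-t / 2) = P := by
    rw [hP, ← Real.rpow_natCast]
    push_cast [Nat.cast_sub hb]
    rfl
  have hDr : D * (Real.pi / (2 * (t / 9))) ^ ((n : ℝ) / 4) = G * t ^ (-(n : ℝ) / 4 - (l : ℝ)) := by
    rw [show Real.pi / (2 * (t / 9)) = (9 * Real.pi / 2) / t by field_simp,
      Real.div_rpow (by positivity) ht0.le, Real.rpow_sub ht0, neg_div, Real.rpow_neg ht0.le,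
      Real.rpow_natCast]
    simp only [D, G, div_pow]
    field_simp
  have hpt : ∀ᵐ ξ : EuclideanSpace ℝ (Fin n), ‖χL ‖ξ‖ *
      (K0 t ‖ξ‖ - Real.exp (-t / 2) * W1 b ‖ξ‖ t - D1 l ‖ξ‖ t)‖
      ≤ B.indicator (fun _ => A * P) ξ + D * Real.exp (-(t / 9) * ‖ξ‖ ^ 2) := by
    have : Nonempty (Fin n) := ⟨⟨0, hn⟩⟩
    filter_upwards [compl_mem_ae_iff.2 (measure_singleton (0 : EuclideanSpace ℝ (Fin n)))]
      with ξ hξ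
    have hξ0 : 0 < ‖ξ‖ := norm_pos_iff.2 hξ
    rcases le_or_gt ‖ξ‖ (1 / 3) with h | h
    · rw [Set.indicator_of_mem (by simpa [B] using h), norm_mul,
        Real.norm_of_nonneg (hχL0 _), Real.norm_eq_abs]
      refine (mul_le_of_le_one_left (abs_nonneg _) (hχL1 _)).trans ?_
      refine (abs_lowFreq_le b l hb hξ0 h ht).trans ?_
      rw [mul_assoc]
      exact add_le_add_right (remainder_le l ‖ξ‖ ht0) _
    · rw [hχLzero _ h.le, zero_mul, norm_zero]
      have : 0 ≤ B.indicator (fun _ => A * P) ξ := Set.indicator_nonneg (fun _ _ => by positivity) _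
      positivity
  calc _ ≤ _ := eLpNorm_mono_ae_real hpt
    _ ≤ eLpNorm (B.indicator (fun _ => A * P)) 2 volume
        + eLpNorm (D • fun ξ : EuclideanSpace ℝ (Fin n) => Real.exp (-(t / 9) * ‖ξ‖ ^ 2)) 2
          volume := by
      refine eLpNorm_add_le ?_ ?_ (by norm_num)
      · exact (measurable_const.indicator measurableSet_closedBall).aestronglyMeasurable
      · exact Continuous.aestronglyMeasurable (by fun_prop)
    _ = ENNReal.ofReal (A * P * V) + ENNReal.ofReal (G * t ^ (-(n : ℝ) / 4 - (l : ℝ))) := by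
      rw [eLpNorm_indicator_const measurableSet_closedBall (by norm_num) (by norm_num),
        eLpNorm_const_smul, eLpNorm_two_gaussian n (by positivity),
        Real.enorm_of_nonneg (by positivity), Real.enorm_of_nonneg (by positivity),
        ← ENNReal.ofReal_mul (by positivity), hDr, ← ENNReal.ofReal_toReal hVfin,
        ← ENNReal.ofReal_mul (by positivity)]
    _ ≤ _ := by
      rw [← ENNReal.ofReal_add (by positivity) (by positivity)]
      refine ENNReal.ofReal_le_ofReal ?_
      rw [mul_assoc (A * V + G), hPr]
      have h1 : 0 ≤ G * P := by positivity
      have h2 : 0 ≤ A * V * t ^ (-(n : ℝ) / 4 - (l : ℝ)) := by positivity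
      linarith
end

section
/- For every m ∈ ℕ, every r ≥ 0 and every t > 0, Σ_{k=0}^{m} (1/k!) ∂_a^k h(r,0,t) = Σ_{j=0}^{m} Σ_{k=0}^{m−j} Σ_{ℓ=0}^{m−j−k} (1/(j!·k!·ℓ!)) · (d^k/ds^k [φ₁(s)^j])|_{s=0} · (d^ℓ/ds^ℓ ψ(s))|_{s=0} · (−tr²)^j · r^{2(j+k+ℓ)} · e^{−tr²}. -/
open Finset in
/-- The Taylor coefficients at `0` of a product of smooth functions. -/
lemma iteratedDeriv_mul_div_factorial {f g : ℝ → ℝ} {n : ℕ} (hf : ContDiffAt ℝ n f 0)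
    (hg : ContDiffAt ℝ n g 0) :
    iteratedDeriv n (fun a => f a * g a) 0 / n.factorial =
      ∑ i ∈ range (n + 1), iteratedDeriv i f 0 / i.factorial *
        (iteratedDeriv (n - i) g 0 / (n - i).factorial) := by
  rw [iteratedDeriv_fun_mul hf hg, sum_div]
  refine sum_congr rfl fun i hi => ?_
  rw [Nat.cast_choose ℝ (Nat.lt_succ_iff.mp (mem_range.mp hi))]
  field_simp

/-- The sum of the Taylor coefficients of `f` at `0` up to order `m`. -/
noncomputable def taylorCoeffSum (m : ℕ) (f : ℝ → ℝ) : ℝ :=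
  ∑ k ∈ Finset.range (m + 1), iteratedDeriv k f 0 / k.factorial

open Finset in
lemma taylorCoeffSum_mul {f g : ℝ → ℝ} (m : ℕ) (hf : AnalyticAt ℝ f 0) (hg : AnalyticAt ℝ g 0) :
    taylorCoeffSum m (fun a => f a * g a) =
      ∑ k ∈ range (m + 1), iteratedDeriv k f 0 / k.factorial * taylorCoeffSum (m - k) g := by
  unfold taylorCoeffSum
  simp_rw [iteratedDeriv_mul_div_factorial hf.contDiffAt hg.contDiffAt]
  rw [sum_range_diag_flip (m + 1) fun i l => iteratedDeriv i f 0 / i.factorial *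
    (iteratedDeriv l g 0 / l.factorial)]
  refine sum_congr rfl fun k hk => ?_
  rw [mul_sum, Nat.sub_add_comm (Nat.lt_succ_iff.mp (mem_range.mp hk))]

lemma taylorCoeffSum_const_mul (m : ℕ) (c : ℝ) (f : ℝ → ℝ) :
    taylorCoeffSum m (fun a => c * f a) = c * taylorCoeffSum m f := by
  simp [taylorCoeffSum, Finset.mul_sum, mul_div_assoc]

lemma taylorCoeffSum_add {f g : ℝ → ℝ} (m : ℕ) (hf : AnalyticAt ℝ f 0) (hg : AnalyticAt ℝ g 0) :
    taylorCoeffSum m (fun a => f a + g a) = taylorCoeffSum m f + taylorCoeffSum m g := by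
  simp [taylorCoeffSum, iteratedDeriv_fun_add hf.contDiffAt hg.contDiffAt, add_div,
    Finset.sum_add_distrib]

lemma taylorCoeffSum_sum {ι : Type*} {s : Finset ι} {f : ι → ℝ → ℝ} (m : ℕ)
    (hf : ∀ i ∈ s, AnalyticAt ℝ (f i) 0) :
    taylorCoeffSum m (fun a => ∑ i ∈ s, f i a) = ∑ i ∈ s, taylorCoeffSum m (f i) := by
  unfold taylorCoeffSum
  simp_rw [iteratedDeriv_fun_sum fun i hi => (hf i hi).contDiffAt, Finset.sum_div]
  exact Finset.sum_comm

lemma taylorCoeffSum_congr {f g : ℝ → ℝ} (m : ℕ) (h : f =ᶠ[nhds 0] g) :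
    taylorCoeffSum m f = taylorCoeffSum m g := by
  simp [taylorCoeffSum, h.iteratedDeriv_eq]

lemma taylorCoeffSum_pow_mul {g : ℝ → ℝ} (m j : ℕ) (hg : AnalyticAt ℝ g 0) :
    taylorCoeffSum m (fun a => a ^ j * g a) =
      if j ≤ m then taylorCoeffSum (m - j) g else 0 := by
  rw [taylorCoeffSum_mul m (f := fun a => a ^ j) (by fun_prop) hg]
  simp only [iteratedDeriv_fun_pow_zero, Nat.cast_ite, Nat.cast_zero, ite_div, zero_div, ite_mul,
    zero_mul]
  simp [Nat.factorial_ne_zero]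

lemma iteratedDeriv_comp_mul_left (n : ℕ) (c x : ℝ) (f : ℝ → ℝ) :
    iteratedDeriv n (fun a => f (c * a)) x = c ^ n * iteratedDeriv n f (c * x) := by
  induction n generalizing f with
  | zero => simp
  | succ n ih =>
    have h : deriv (fun a => f (c * a)) = fun a => c * deriv f (c * a) :=
      funext fun a => deriv_comp_mul_left c f a
    rw [iteratedDeriv_succ', h, iteratedDeriv_const_mul_field, ih, iteratedDeriv_succ']
    ring

/-- Expanding the exponential in powers of `c * a * φ a` is exact for Taylor coefficients at `0`,
since the `j`-th term vanishes to order `j`. -/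
lemma taylorCoeffSum_mul_exp {φ g : ℝ → ℝ} (m : ℕ) (c : ℝ) (hφ : AnalyticAt ℝ φ 0)
    (hg : AnalyticAt ℝ g 0) :
    taylorCoeffSum m (fun a => g a * Real.exp (c * a * φ a)) =
      ∑ j ∈ Finset.range (m + 1), c ^ j / j.factorial *
        taylorCoeffSum (m - j) (fun a => φ a ^ j * g a) := by
  obtain ⟨R, hR, hexp⟩ :=
    (analyticAt_rexp (x := 0)).exists_eq_sum_add_pow_mul (m + 1)
  have hu : AnalyticAt ℝ (fun a => c * a * φ a) 0 := by fun_prop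
  have hRu : AnalyticAt ℝ (fun a => R (c * a * φ a)) 0 :=
    AnalyticAt.fun_comp (by simpa using hR) hu
  have hrem : AnalyticAt ℝ
      (fun a => c ^ (m + 1) * φ a ^ (m + 1) * R (c * a * φ a) * g a) 0 :=
    ((analyticAt_const.fun_mul (hφ.fun_pow _)).fun_mul hRu).fun_mul hg
  have hsplit : (fun a => g a * Real.exp (c * a * φ a)) = fun a =>
      ∑ j ∈ Finset.range (m + 1), c ^ j / j.factorial * (a ^ j * (φ a ^ j * g a)) +
        a ^ (m + 1) * (c ^ (m + 1) * φ a ^ (m + 1) * R (c * a * φ a) * g a) := by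
    funext a
    rw [hexp, mul_add, Finset.mul_sum]
    congr 1
    · refine Finset.sum_congr rfl fun j _ => ?_
      rw [iteratedDeriv_eq_iterate, Real.iter_deriv_exp, Real.exp_zero, smul_eq_mul]
      ring
    · rw [smul_eq_mul]
      ring
  rw [hsplit, taylorCoeffSum_add m (Finset.analyticAt_fun_sum _ fun j _ => by fun_prop)
      (AnalyticAt.fun_mul (by fun_prop) hrem), taylorCoeffSum_sum m (fun j _ => by fun_prop),
    taylorCoeffSum_pow_mul m (m + 1) hrem, if_neg (by lia), add_zero]
  refine Finset.sum_congr rfl fun j hj => ?_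
  rw [taylorCoeffSum_const_mul, taylorCoeffSum_pow_mul m j (by fun_prop),
    if_pos (Nat.lt_succ_iff.mp (Finset.mem_range.mp hj))]

lemma analyticAt_sqrt {x : ℝ} (hx : 0 < x) : AnalyticAt ℝ Real.sqrt x :=
  (Real.contDiffAt_sqrt hx.ne').analyticAt

lemma two_div_one_add_sqrt {s : ℝ} (hs : 4 * s ≤ 1) :
    2 / (1 + √(1 - 4 * s)) = 1 + s * ((1 / 2 + √(1 / 4 - s)) ^ 2)⁻¹ := by
  have h : √(1 / 4 - s) = √(1 - 4 * s) / 2 := by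
    rw [show 1 / 4 - s = (1 - 4 * s) / 2 ^ 2 by ring, Real.sqrt_div' _ (by positivity),
      Real.sqrt_sq (by norm_num)]
  have hS := Real.sq_sqrt (show 0 ≤ 1 - 4 * s by linarith)
  have hS0 := Real.sqrt_nonneg (1 - 4 * s)
  rw [h]
  field_simp
  linear_combination -hS

/-- Equivalence of the author's expansion of the diffusive part `D²` with the
Takeda expansion: for every `m ≥ 1`, `r ≥ 0`, `t > 0`,
`Σ_{k=0}^m (1/k!) ∂_a^k h(r,0,t)
  = Σ_{j=0}^m Σ_{k=0}^{m−j} Σ_{ℓ=0}^{m−j−k} (1/(j!k!ℓ!)) (d^k/ds^k φ₁(s)^j)|₀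
      (d^ℓ/ds^ℓ ψ(s))|₀ (−tr²)^j r^{2(j+k+ℓ)} e^{−tr²}`,
where `h(r,a,t) = (1−4ar²)^{−1/2} exp(−2tr²/(1+√(1−4ar²)))`,
`φ₁(s) = (1/2+√(1/4−s))^{−2}` and `ψ(s) = (1−4s)^{−1/2}`. -/
theorem stmt_17 (m : ℕ) (hm : 1 ≤ m) (r : ℝ) (hr : 0 ≤ r) (t : ℝ) (ht : 0 < t) :
    ∑ k ∈ Finset.range (m + 1), (1 / (Nat.factorial k) : ℝ) *
        iteratedDeriv k
          (fun a : ℝ => (Real.sqrt (1 - 4 * a * r ^ 2))⁻¹ *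
            Real.exp (-(2 * t * r ^ 2) / (1 + Real.sqrt (1 - 4 * a * r ^ 2)))) 0
    = ∑ j ∈ Finset.range (m + 1), ∑ k ∈ Finset.range (m - j + 1),
        ∑ l ∈ Finset.range (m - j - k + 1),
        (1 / ((Nat.factorial j : ℝ) * (Nat.factorial k) * (Nat.factorial l)) : ℝ) *
          iteratedDeriv k (fun s : ℝ => (((1/2 + Real.sqrt (1/4 - s)) ^ 2)⁻¹) ^ j) 0 *
          iteratedDeriv l (fun s : ℝ => (Real.sqrt (1 - 4 * s))⁻¹) 0 *
          (-(t * r ^ 2)) ^ j * r ^ (2 * (j + k + l)) * Real.exp (-t * r ^ 2) := by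
  set x := r ^ 2 with hx
  set φ : ℝ → ℝ := fun s => ((1 / 2 + √(1 / 4 - s)) ^ 2)⁻¹
  set ψ : ℝ → ℝ := fun s => (√(1 - 4 * s))⁻¹
  have hφ : AnalyticAt ℝ φ 0 := by
    have h : AnalyticAt ℝ (fun s : ℝ => √(1 / 4 - s)) 0 :=
      (analyticAt_sqrt (by norm_num)).fun_comp (by fun_prop)
    have h0 : (1 / 2 + √(1 / 4 - 0)) ^ 2 ≠ 0 := by positivity
    exact ((analyticAt_const.fun_add h).fun_pow 2).fun_inv h0
  have hψ : AnalyticAt ℝ ψ 0 := by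
    have h : AnalyticAt ℝ (fun s : ℝ => √(1 - 4 * s)) 0 :=
      (analyticAt_sqrt (by norm_num)).fun_comp (by fun_prop)
    exact h.inv (by norm_num)
  have hφx : AnalyticAt ℝ (fun a => φ (x * a)) 0 :=
    AnalyticAt.fun_comp (by simpa using hφ) (by fun_prop)
  have hψx : AnalyticAt ℝ (fun a => ψ (x * a)) 0 :=
    AnalyticAt.fun_comp (by simpa using hψ) (by fun_prop)
  have hlocal : (fun a : ℝ => (√(1 - 4 * a * x))⁻¹ *
      Real.exp (-(2 * t * x) / (1 + √(1 - 4 * a * x)))) =ᶠ[nhds 0]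
      fun a => Real.exp (-t * x) * (ψ (x * a) * Real.exp (-(t * x) * x * a * φ (x * a))) := by
    have hcont : Filter.Tendsto (fun a : ℝ => 4 * (x * a)) (nhds 0) (nhds 0) :=
      Continuous.tendsto' (by fun_prop) _ _ (by simp)
    filter_upwards [hcont.eventually_le_const one_pos] with a ha
    have hexponent : -(2 * t * x) / (1 + √(1 - 4 * (x * a))) =
        -t * x + -(t * x) * x * a * φ (x * a) := by
      linear_combination (-(t * x)) * two_div_one_add_sqrt ha
    rw [show 4 * a * x = 4 * (x * a) by ring, hexponent, Real.exp_add]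
    ring
  calc
    _ = taylorCoeffSum m (fun a : ℝ => (√(1 - 4 * a * x))⁻¹ *
          Real.exp (-(2 * t * x) / (1 + √(1 - 4 * a * x)))) :=
      Finset.sum_congr rfl fun k _ => by ring
    _ = Real.exp (-t * x) * ∑ j ∈ Finset.range (m + 1), (-(t * x) * x) ^ j / j.factorial *
          taylorCoeffSum (m - j) (fun a => φ (x * a) ^ j * ψ (x * a)) := by
      rw [taylorCoeffSum_congr m hlocal, taylorCoeffSum_const_mul,
        taylorCoeffSum_mul_exp m _ hφx hψx]
    _ = _ := by
      rw [Finset.mul_sum]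
      refine Finset.sum_congr rfl fun j _ => ?_
      rw [taylorCoeffSum_mul _ (hφx.fun_pow j) hψx, Finset.mul_sum, Finset.mul_sum]
      refine Finset.sum_congr rfl fun k _ => ?_
      rw [taylorCoeffSum, Finset.mul_sum, Finset.mul_sum, Finset.mul_sum]
      refine Finset.sum_congr rfl fun l _ => ?_
      rw [iteratedDeriv_comp_mul_left k x 0 (fun s => φ s ^ j),
        iteratedDeriv_comp_mul_left l x 0 ψ, mul_zero, pow_mul, ← hx]
      change _ = _ * iteratedDeriv k (fun s => φ s ^ j) 0 * iteratedDeriv l ψ 0 * _ * _ * _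
      field_simp
      ring
end
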